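/- (Monotonicity-type formula for the potential) Let ε > 0, let u_ε be a solution of the vectorial Allen–Cahn system on Ω, and let x₀ ∈ Ω. Then for every r with 0 < r < dist(x₀,∂Ω), the function r ↦ (1/(ε r))·∫_{D(x₀,r)} V(u_ε) dx is differentiable and its derivative equals (1/(4r))·∫_{∂D(x₀,r)} ( ε|∂u_ε/∂ν|² − ε|∂u_ε/∂τ|² + (2/ε)·V(u_ε) ) dℓ, where ∂/∂ν and ∂/∂τ are the outward normal and tangential derivatives on the circle ∂D(x₀,r) and dℓ is arclength. -/

import Mathlib

open MeasureTheory Metric Filter Topology Bornology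
open scoped RealInnerProductSpace ENNReal Topology

noncomputable section

/-- The euclidean plane. -/
abbrev E2 : Type := EuclideanSpace ℝ (Fin 2)

/-- The euclidean space `ℝ^k`. -/
abbrev Evec (k : ℕ) : Type := EuclideanSpace ℝ (Fin k)

/-- The `i`-th standard basis vector of the plane. -/
def b2 (i : Fin 2) : E2 := EuclideanSpace.single i (1 : ℝ)

/-- The partial derivative of `u` in the `i`-th coordinate direction. -/
def pder {k : ℕ} (u : E2 → Evec k) (i : Fin 2) (x : E2) : Evec k :=
  fderiv ℝ u x (b2 i)

/-- The Laplacian of a map defined on the plane. -/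
def lap {k : ℕ} (u : E2 → Evec k) (x : E2) : Evec k :=
  ∑ i : Fin 2, fderiv ℝ (pder u i) x (b2 i)

/-- `u` is a smooth solution of the vectorial Allen-Cahn system
`Δu = ε⁻² ∇V(u)` on the open set `U`. -/
def IsSolution {k : ℕ} (V : Evec k → ℝ) (ε : ℝ) (U : Set E2) (u : E2 → Evec k) : Prop :=
  ContDiffOn ℝ (⊤ : ℕ∞) u U ∧ ∀ x ∈ U, lap u x = (ε ^ 2)⁻¹ • gradient V (u x)

/-- The squared modulus `|∇u|²` of the full gradient. -/
def gradSq {k : ℕ} (u : E2 → Evec k) (x : E2) : ℝ :=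
  ∑ i : Fin 2, ‖pder u i x‖ ^ 2

/-- The energy density `e_ε(u) = (ε/2)|∇u|² + ε⁻¹ V(u)`. -/
def eDens {k : ℕ} (V : Evec k → ℝ) (ε : ℝ) (u : E2 → Evec k) (x : E2) : ℝ :=
  ε / 2 * gradSq u x + ε⁻¹ * V (u x)

/-- The energy `E_ε(u, G)`. -/
def energy {k : ℕ} (V : Evec k → ℝ) (ε : ℝ) (u : E2 → Evec k) (G : Set E2) : ℝ :=
  ∫ x in G, eDens V ε u x

/-- The hypotheses (H₁), (H₂), (H₃) on the multi-well potential `V`: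
smooth, nonnegative with `inf V = 0`, finitely many zeros (at least two),
positive definite Hessian at each zero, quadratic growth of `y·∇V(y)` at
infinity and coercivity. -/
structure IsMultiWell {k : ℕ} (V : Evec k → ℝ) : Prop where
  smooth : ContDiff ℝ (⊤ : ℕ∞) V
  nonneg : ∀ y, 0 ≤ V y
  finite_zeros : {y : Evec k | V y = 0}.Finite
  two_le_card : 2 ≤ {y : Evec k | V y = 0}.ncard
  hess_posdef : ∀ σ : Evec k, V σ = 0 → ∀ w : Evec k, w ≠ 0 →
    0 < iteratedFDeriv ℝ 2 V σ ![w, w]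
  growth : ∃ α > (0 : ℝ), ∃ R > (0 : ℝ), ∀ y : Evec k, R < ‖y‖ →
    α * ‖y‖ ^ 2 ≤ ⟪y, gradient V y⟫
  coercive : ∀ C : ℝ, ∃ R : ℝ, ∀ y : Evec k, R ≤ ‖y‖ → C ≤ V y

/-- The point of the plane with coordinates `(a, b)`. -/
def vec2 (a b : ℝ) : E2 :=
  EuclideanSpace.single (0 : Fin 2) a + EuclideanSpace.single (1 : Fin 2) b

/-- The point of the circle of center `x₀` and radius `r` at angle `θ`. -/
def circPt (x₀ : E2) (r θ : ℝ) : E2 := x₀ + vec2 (r * Real.cos θ) (r * Real.sin θ)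

/-- The outward unit normal vector of a circle at angle `θ`. -/
def norv (θ : ℝ) : E2 := vec2 (Real.cos θ) (Real.sin θ)

/-- The unit tangent vector of a circle at angle `θ`. -/
def tanv (θ : ℝ) : E2 := vec2 (-Real.sin θ) (Real.cos θ)

/-! ### Polar coordinates in the plane -/

theorem vec2_eq_smul (a b : ℝ) : vec2 a b = a • b2 0 + b • b2 1 := by
  ext i; fin_cases i <;> simp [vec2, b2]

theorem norm_vec2_sq (a b : ℝ) : ‖vec2 a b‖ ^ 2 = a ^ 2 + b ^ 2 := by
  rw [EuclideanSpace.real_norm_sq_eq]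
  simp [vec2]

theorem circPt_eq (x₀ : E2) (r θ : ℝ) : circPt x₀ r θ = x₀ + r • norv θ := by
  simp only [circPt, norv, vec2_eq_smul, smul_add, smul_smul]

theorem norv_eq : norv = fun θ => Real.cos θ • b2 0 + Real.sin θ • b2 1 :=
  funext fun _ => vec2_eq_smul _ _

theorem tanv_eq : tanv = fun θ => -Real.sin θ • b2 0 + Real.cos θ • b2 1 :=
  funext fun _ => vec2_eq_smul _ _

theorem norm_norv (θ : ℝ) : ‖norv θ‖ = 1 := by
  have h : ‖norv θ‖ ^ 2 = 1 := by rw [norv, norm_vec2_sq, Real.cos_sq_add_sin_sq]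
  exact (pow_eq_one_iff_of_nonneg (norm_nonneg _) two_ne_zero).1 h

theorem dist_circPt (x₀ : E2) {r : ℝ} (hr : 0 ≤ r) (θ : ℝ) : dist (circPt x₀ r θ) x₀ = r := by
  rw [circPt_eq, dist_eq_norm, add_sub_cancel_left, norm_smul, norm_norv, mul_one,
    Real.norm_of_nonneg hr]

@[fun_prop]
theorem continuous_norv : Continuous norv := by
  rw [norv_eq]
  fun_prop

@[fun_prop]
theorem continuous_tanv : Continuous tanv := by
  rw [tanv_eq]
  fun_prop

theorem hasDerivAt_norv (θ : ℝ) : HasDerivAt norv (tanv θ) θ := by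
  rw [norv_eq, tanv_eq]
  exact ((Real.hasDerivAt_cos θ).smul_const _).add ((Real.hasDerivAt_sin θ).smul_const _)

theorem hasDerivAt_tanv (θ : ℝ) : HasDerivAt tanv (-norv θ) θ := by
  simp only [norv_eq, tanv_eq, neg_add, ← neg_smul]
  exact ((Real.hasDerivAt_sin θ).neg.smul_const _).add ((Real.hasDerivAt_cos θ).smul_const _)

theorem norv_periodic : Function.Periodic norv (2 * Real.pi) := fun θ => by
  simp [norv]

theorem tanv_periodic : Function.Periodic tanv (2 * Real.pi) := fun θ => by
  simp [tanv]

theorem hasDerivAt_circPt_radius (x₀ : E2) (r θ : ℝ) :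
    HasDerivAt (fun s => circPt x₀ s θ) (norv θ) r := by
  simp only [circPt_eq]
  simpa using ((hasDerivAt_id r).smul_const (norv θ)).const_add x₀

theorem hasDerivAt_circPt_angle (x₀ : E2) (r θ : ℝ) :
    HasDerivAt (fun φ => circPt x₀ r φ) (r • tanv θ) θ := by
  simp only [circPt_eq]
  exact ((hasDerivAt_norv θ).const_smul r).const_add x₀

theorem continuous_circPt (x₀ : E2) : Continuous fun p : ℝ × ℝ => circPt x₀ p.1 p.2 := by
  simp only [circPt_eq]
  fun_prop

theorem measurableEmbedding_vec2 : MeasurableEmbedding fun p : ℝ × ℝ => vec2 p.1 p.2 := by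
  convert! (MeasurableEquiv.toLp 2 (Fin 2 → ℝ)).measurableEmbedding.comp
    (MeasurableEquiv.finTwoArrow (α := ℝ)).symm.measurableEmbedding using 1
  ext p i; fin_cases i <;> simp [vec2]

theorem measurePreserving_vec2 :
    MeasurePreserving (fun p : ℝ × ℝ => vec2 p.1 p.2) volume volume := by
  convert! (PiLp.volume_preserving_toLp (Fin 2)).comp (volume_preserving_finTwoArrow ℝ).symm
    using 1
  ext p i; fin_cases i <;> simp [vec2]

theorem setIntegral_ball_eq_polar {f : E2 → ℝ} (hf : Continuous f) (x₀ : E2) {s : ℝ}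
    (hs : 0 ≤ s) :
    ∫ x in ball x₀ s, f x =
      ∫ ρ in (0 : ℝ)..s, ∫ θ in (0 : ℝ)..(2 * Real.pi), ρ * f (circPt x₀ ρ θ) := by
  have hcont : Continuous fun p : ℝ × ℝ => p.1 * f (circPt x₀ p.1 p.2) :=
    continuous_fst.mul (hf.comp (continuous_circPt x₀))
  have hint : IntegrableOn (fun p : ℝ × ℝ => p.1 * f (circPt x₀ p.1 p.2))
      (Set.Ioo 0 s ×ˢ Set.Ioo (-Real.pi) Real.pi) :=
    (hcont.continuousOn.integrableOn_compact (isCompact_Icc.prod isCompact_Icc)).mono_set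
      (Set.prod_mono Set.Ioo_subset_Icc_self Set.Ioo_subset_Icc_self)
  calc ∫ x in ball x₀ s, f x
      = ∫ x, (ball x₀ s).indicator f x := (integral_indicator measurableSet_ball).symm
    _ = ∫ x, (ball x₀ s).indicator f (x₀ + x) := (integral_add_left_eq_self _ x₀).symm
    _ = ∫ p : ℝ × ℝ, (ball x₀ s).indicator f (x₀ + vec2 p.1 p.2) :=
        (measurePreserving_vec2.integral_comp measurableEmbedding_vec2 _).symm
    _ = ∫ p in polarCoord.target, p.1 • (ball x₀ s).indicator f (circPt x₀ p.1 p.2) :=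
        (integral_comp_polarCoord_symm _).symm
    _ = ∫ p in polarCoord.target, (Set.Iio s ×ˢ Set.univ).indicator
          (fun p : ℝ × ℝ => p.1 * f (circPt x₀ p.1 p.2)) p := by
        refine setIntegral_congr_fun polarCoord.open_target.measurableSet fun p hp => ?_
        have hp0 : 0 < p.1 := hp.1
        simp only [Set.indicator, mem_ball, dist_circPt x₀ hp0.le, Set.mem_prod, Set.mem_Iio,
          Set.mem_univ, and_true, smul_eq_mul, mul_ite, mul_zero]
    _ = ∫ p in Set.Ioo 0 s ×ˢ Set.Ioo (-Real.pi) Real.pi, p.1 * f (circPt x₀ p.1 p.2) := by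
        rw [setIntegral_indicator (measurableSet_Iio.prod MeasurableSet.univ), polarCoord_target,
          Set.prod_inter_prod, Set.inter_univ, Set.Ioi_inter_Iio]
    _ = ∫ ρ in Set.Ioo 0 s, ∫ θ in Set.Ioo (-Real.pi) Real.pi, ρ * f (circPt x₀ ρ θ) :=
        setIntegral_prod _ hint
    _ = ∫ ρ in (0 : ℝ)..s, ∫ θ in (0 : ℝ)..(2 * Real.pi), ρ * f (circPt x₀ ρ θ) := by
        rw [intervalIntegral.integral_of_le hs, ← integral_Ioc_eq_integral_Ioo]
        refine setIntegral_congr_fun measurableSet_Ioc fun ρ _ => ?_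
        have hper : Function.Periodic (fun θ => ρ * f (circPt x₀ ρ θ)) (2 * Real.pi) := fun θ => by
          simp only [circPt_eq, norv_periodic θ]
        have h := hper.intervalIntegral_add_eq (-Real.pi) 0
        rw [zero_add, show -Real.pi + 2 * Real.pi = Real.pi by ring,
          intervalIntegral.integral_of_le (by linarith [Real.pi_pos]),
          integral_Ioc_eq_integral_Ioo] at h
        exact h

/-! ### Pohozaev identity on disks -/

/-- The Laplacian is the trace of the second derivative in the frame `(norv θ, tanv θ)`. -/
theorem lap_eq_polar_frame {k : ℕ} {u : E2 → Evec k} {x : E2}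
    (hu : DifferentiableAt ℝ (fderiv ℝ u) x) (θ : ℝ) :
    lap u x = fderiv ℝ (fderiv ℝ u) x (norv θ) (norv θ)
      + fderiv ℝ (fderiv ℝ u) x (tanv θ) (tanv θ) := by
  have h : ∀ i, fderiv ℝ (pder u i) x (b2 i) = fderiv ℝ (fderiv ℝ u) x (b2 i) (b2 i) := fun i => by
    have : fderiv ℝ (pder u i) x = _ :=
      (hu.hasFDerivAt.clm_apply (hasFDerivAt_const (b2 i) x)).fderiv
    simp [this]
  simp only [lap, Fin.sum_univ_two, h, norv, tanv, vec2_eq_smul, map_add, map_smul,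
    add_apply, smul_apply]
  have h0 := congrArg (· • (fderiv ℝ (fderiv ℝ u) x (b2 0) (b2 0)
    + fderiv ℝ (fderiv ℝ u) x (b2 1) (b2 1))) (Real.sin_sq_add_cos_sq θ)
  simp only [one_smul] at h0
  rw [← h0]
  module

section Pohozaev

variable {k : ℕ} {u : E2 → Evec k}

/-- The derivative in `θ` of the product of the normal and tangential derivatives of `u`. -/
def crossDeriv (u : E2 → Evec k) (x₀ : E2) (s θ : ℝ) : ℝ :=
  ⟪fderiv ℝ u (circPt x₀ s θ) (norv θ),
      s • fderiv ℝ (fderiv ℝ u) (circPt x₀ s θ) (tanv θ) (tanv θ)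
        - fderiv ℝ u (circPt x₀ s θ) (norv θ)⟫
    + ⟪s • fderiv ℝ (fderiv ℝ u) (circPt x₀ s θ) (tanv θ) (norv θ)
        + fderiv ℝ u (circPt x₀ s θ) (tanv θ), fderiv ℝ u (circPt x₀ s θ) (tanv θ)⟫

theorem hasDerivAt_inner_normal_tangential (hu : Differentiable ℝ (fderiv ℝ u)) (x₀ : E2)
    (s θ : ℝ) :
    HasDerivAt (fun φ => ⟪fderiv ℝ u (circPt x₀ s φ) (norv φ),
      fderiv ℝ u (circPt x₀ s φ) (tanv φ)⟫) (crossDeriv u x₀ s θ) θ := by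
  have hD : HasDerivAt (fun φ => fderiv ℝ u (circPt x₀ s φ))
      (fderiv ℝ (fderiv ℝ u) (circPt x₀ s θ) (s • tanv θ)) θ :=
    (hu _).hasFDerivAt.comp_hasDerivAt θ (hasDerivAt_circPt_angle x₀ s θ)
  convert! (hD.clm_apply (hasDerivAt_norv θ)).inner ℝ (hD.clm_apply (hasDerivAt_tanv θ)) using 1
  simp [crossDeriv, sub_eq_add_neg]

theorem integral_crossDeriv (hu : Differentiable ℝ (fderiv ℝ u)) (x₀ : E2) (s : ℝ)
    (hc : Continuous (crossDeriv u x₀ s)) :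
    ∫ θ in (0 : ℝ)..(2 * Real.pi), crossDeriv u x₀ s θ = 0 := by
  rw [intervalIntegral.integral_eq_sub_of_hasDerivAt
    (fun θ _ => hasDerivAt_inner_normal_tangential hu x₀ s θ) (hc.intervalIntegrable _ _)]
  have h1 := norv_periodic 0
  have h2 := tanv_periodic 0
  rw [zero_add] at h1 h2
  simp only [circPt_eq, h1, h2, sub_self]

/-- The density on circles whose angular integral is twice the potential energy of the disk. -/
def pohozaevDensity (V : Evec k → ℝ) (ε : ℝ) (u : E2 → Evec k) (x₀ : E2) (s θ : ℝ) : ℝ :=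
  s ^ 2 * (V (u (circPt x₀ s θ)) - ε ^ 2 / 2 * (‖fderiv ℝ u (circPt x₀ s θ) (norv θ)‖ ^ 2
    - ‖fderiv ℝ u (circPt x₀ s θ) (tanv θ)‖ ^ 2))

theorem hasDerivAt_pohozaevDensity {V : Evec k → ℝ} {ε : ℝ} {x₀ : E2} {s θ : ℝ} (hε : ε ≠ 0)
    (hV : Differentiable ℝ V) (hu : ContDiff ℝ 2 u)
    (hpde : lap u (circPt x₀ s θ) = (ε ^ 2)⁻¹ • gradient V (u (circPt x₀ s θ))) :
    HasDerivAt (fun s => pohozaevDensity V ε u x₀ s θ)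
      (2 * (s * V (u (circPt x₀ s θ))) + ε ^ 2 * s * crossDeriv u x₀ s θ) s := by
  have hu1 : Differentiable ℝ u := hu.differentiable (by norm_num)
  have hu2 : Differentiable ℝ (fderiv ℝ u) :=
    (hu.fderiv_right (m := 1) (by norm_num)).differentiable (by norm_num)
  have hc := hasDerivAt_circPt_radius x₀ s θ
  have hD : HasDerivAt (fun s => fderiv ℝ u (circPt x₀ s θ))
      (fderiv ℝ (fderiv ℝ u) (circPt x₀ s θ) (norv θ)) s :=
    (hu2 _).hasFDerivAt.comp_hasDerivAt s hc
  have hn := (hD.clm_apply (hasDerivAt_const s (norv θ))).norm_sq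
  have ht := (hD.clm_apply (hasDerivAt_const s (tanv θ))).norm_sq
  have hVu : HasDerivAt (fun s => V (u (circPt x₀ s θ)))
      ⟪gradient V (u (circPt x₀ s θ)), fderiv ℝ u (circPt x₀ s θ) (norv θ)⟫ s := by
    exact (hV _).hasGradientAt.hasFDerivAt.comp_hasDerivAt s
      ((hu1 _).hasFDerivAt.comp_hasDerivAt s hc)
  have hsymm : fderiv ℝ (fderiv ℝ u) (circPt x₀ s θ) (tanv θ) (norv θ)
      = fderiv ℝ (fderiv ℝ u) (circPt x₀ s θ) (norv θ) (tanv θ) :=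
    (hu.contDiffAt.isSymmSndFDerivAt (by simp)).eq _ _
  have hgrad : gradient V (u (circPt x₀ s θ)) = (ε ^ 2) •
      (fderiv ℝ (fderiv ℝ u) (circPt x₀ s θ) (norv θ) (norv θ)
        + fderiv ℝ (fderiv ℝ u) (circPt x₀ s θ) (tanv θ) (tanv θ)) := by
    rw [← lap_eq_polar_frame (hu2 _) θ, hpde, smul_inv_smul₀ (pow_ne_zero 2 hε)]
  convert! ((hasDerivAt_id s).pow 2).mul (hVu.sub ((hn.sub ht).const_mul (ε ^ 2 / 2))) using 1
  simp only [crossDeriv, hsymm, hgrad, map_zero, add_zero, inner_add_left, inner_sub_right,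
    inner_smul_left, inner_smul_right, real_inner_self_eq_norm_sq, RCLike.conj_to_real, id_eq]
  rw [real_inner_comm (fderiv ℝ u (circPt x₀ s θ) (norv θ))
      (fderiv ℝ (fderiv ℝ u) (circPt x₀ s θ) (norv θ) (norv θ)),
    real_inner_comm (fderiv ℝ u (circPt x₀ s θ) (norv θ))
      (fderiv ℝ (fderiv ℝ u) (circPt x₀ s θ) (tanv θ) (tanv θ)),
    real_inner_comm (fderiv ℝ u (circPt x₀ s θ) (tanv θ))
      (fderiv ℝ (fderiv ℝ u) (circPt x₀ s θ) (norv θ) (tanv θ))]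
  simp
  ring

theorem continuous_crossDeriv {X : Type*} [TopologicalSpace X] {σ φ : X → ℝ}
    (hu : ContDiff ℝ 2 u) (x₀ : E2) (hσ : Continuous σ) (hφ : Continuous φ) :
    Continuous fun p => crossDeriv u x₀ (σ p) (φ p) := by
  have hu1 : ContDiff ℝ 1 (fderiv ℝ u) := hu.fderiv_right (by norm_num)
  have hDc : Continuous (fderiv ℝ u) := hu1.continuous
  have hDDc : Continuous (fderiv ℝ (fderiv ℝ u)) := hu1.continuous_fderiv (by norm_num)
  simp only [crossDeriv, circPt_eq]
  fun_prop

/-- The fundamental theorem of calculus in the first variable, integrated over the second one. -/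
theorem integral_integral_eq_of_hasDerivAt {F G : ℝ → ℝ → ℝ} {r a b : ℝ} (hr : 0 ≤ r)
    (hF : Continuous (Function.uncurry F)) (hG0 : ∀ θ, G 0 θ = 0)
    (hG : ∀ s ∈ Set.Icc 0 r, ∀ θ, HasDerivAt (fun s => G s θ) (F s θ) s) :
    ∫ s in (0 : ℝ)..r, ∫ θ in a..b, F s θ = ∫ θ in a..b, G r θ := by
  rw [intervalIntegral_intervalIntegral_swap ((hF.continuousOn.integrableOn_compact
      (isCompact_uIcc.prod isCompact_uIcc)).mono_set
      (Set.prod_mono Set.uIoc_subset_uIcc Set.uIoc_subset_uIcc))]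
  refine intervalIntegral.integral_congr fun θ _ => ?_
  have hi : Continuous fun s => F s θ := hF.comp (Continuous.prodMk_left θ)
  have h := intervalIntegral.integral_eq_sub_of_hasDerivAt
    (fun s hs => hG s (Set.uIcc_of_le hr ▸ hs) θ) (hi.intervalIntegrable 0 r)
  rwa [hG0, sub_zero] at h

theorem two_mul_setIntegral_ball_eq {V : Evec k → ℝ} {ε : ℝ} (hε : ε ≠ 0)
    (hV : ContDiff ℝ 1 V) (hu : ContDiff ℝ 2 u) (x₀ : E2) {r : ℝ} (hr : 0 ≤ r)
    (hpde : ∀ x ∈ closedBall x₀ r, lap u x = (ε ^ 2)⁻¹ • gradient V (u x)) :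
    2 * ∫ x in ball x₀ r, V (u x) =
      ∫ θ in (0 : ℝ)..(2 * Real.pi), pohozaevDensity V ε u x₀ r θ := by
  have hVu : Continuous fun x => V (u x) := hV.continuous.comp hu.continuous
  have hu1 : ContDiff ℝ 1 (fderiv ℝ u) := hu.fderiv_right (by norm_num)
  have hpot : Continuous fun p : ℝ × ℝ => p.1 * V (u (circPt x₀ p.1 p.2)) :=
    continuous_fst.mul (hVu.comp (continuous_circPt x₀))
  have hF : Continuous (Function.uncurry fun s θ =>
      2 * (s * V (u (circPt x₀ s θ))) + ε ^ 2 * s * crossDeriv u x₀ s θ) :=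
    (hpot.const_mul 2).add ((continuous_fst.const_mul (ε ^ 2)).mul
      (continuous_crossDeriv hu x₀ continuous_fst continuous_snd))
  have hG : ∀ s ∈ Set.Icc 0 r, ∀ θ, HasDerivAt (fun s => pohozaevDensity V ε u x₀ s θ)
      (2 * (s * V (u (circPt x₀ s θ))) + ε ^ 2 * s * crossDeriv u x₀ s θ) s := fun s hs θ => by
    refine hasDerivAt_pohozaevDensity hε (hV.differentiable (by norm_num)) hu (hpde _ ?_)
    rw [mem_closedBall, dist_circPt x₀ hs.1]
    exact hs.2
  rw [← integral_integral_eq_of_hasDerivAt hr hF (fun θ => by simp [pohozaevDensity]) hG,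
    setIntegral_ball_eq_polar hVu x₀ hr, ← intervalIntegral.integral_const_mul]
  refine intervalIntegral.integral_congr fun s _ => ?_
  have hcs : Continuous fun θ => crossDeriv u x₀ s θ :=
    continuous_crossDeriv hu x₀ continuous_const continuous_id
  have hps : Continuous fun θ => s * V (u (circPt x₀ s θ)) :=
    hpot.comp (Continuous.prodMk_right s)
  have h1 : IntervalIntegrable (fun θ => 2 * (s * V (u (circPt x₀ s θ)))) volume 0
      (2 * Real.pi) := (hps.const_mul 2).intervalIntegrable _ _
  have h2 : IntervalIntegrable (fun θ => ε ^ 2 * s * crossDeriv u x₀ s θ) volume 0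
      (2 * Real.pi) := (hcs.const_mul (ε ^ 2 * s)).intervalIntegrable _ _
  have h3 := integral_crossDeriv (hu1.differentiable (by norm_num)) x₀ s hcs
  have h4 := intervalIntegral.integral_add h1 h2
  rw [intervalIntegral.integral_const_mul 2, intervalIntegral.integral_const_mul (ε ^ 2 * s), h3,
    mul_zero, add_zero] at h4
  exact h4.symm

theorem hasDerivAt_setIntegral_ball {f : E2 → ℝ} (hf : Continuous f) (x₀ : E2) {r : ℝ}
    (hr : 0 < r) :
    HasDerivAt (fun s => ∫ x in ball x₀ s, f x)
      (r * ∫ θ in (0 : ℝ)..(2 * Real.pi), f (circPt x₀ r θ)) r := by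
  have hg : Continuous fun p : ℝ × ℝ => p.1 * f (circPt x₀ p.1 p.2) :=
    continuous_fst.mul (hf.comp (continuous_circPt x₀))
  have hc : Continuous fun s => ∫ θ in (0 : ℝ)..(2 * Real.pi), s * f (circPt x₀ s θ) :=
    intervalIntegral.continuous_parametric_intervalIntegral_of_continuous' hg _ _
  have h := (hc.integral_hasStrictDerivAt 0 r).hasDerivAt
  rw [intervalIntegral.integral_const_mul] at h
  refine h.congr_of_eventuallyEq ?_
  filter_upwards [lt_mem_nhds hr] with s hs
  exact setIntegral_ball_eq_polar hf x₀ hs.le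

/-- The monotonicity-type formula for a solution on a closed disk which extends to a `C²` map of
the plane. -/
theorem hasDerivAt_potential_of_contDiff {V : Evec k → ℝ} {ε : ℝ} (hε : ε ≠ 0)
    (hV : ContDiff ℝ 1 V) (hu : ContDiff ℝ 2 u) (x₀ : E2) {r : ℝ} (hr : 0 < r)
    (hpde : ∀ x ∈ closedBall x₀ r, lap u x = (ε ^ 2)⁻¹ • gradient V (u x)) :
    HasDerivAt (fun s : ℝ => (1 / (ε * s)) * ∫ x in ball x₀ s, V (u x))
      ((1 / (4 * r)) * ∫ θ in (0 : ℝ)..(2 * Real.pi),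
        (ε * ‖fderiv ℝ u (circPt x₀ r θ) (norv θ)‖ ^ 2 -
          ε * ‖fderiv ℝ u (circPt x₀ r θ) (tanv θ)‖ ^ 2 +
          (2 / ε) * V (u (circPt x₀ r θ))) * r) r := by
  have hVc : Continuous V := hV.continuous
  have huc : Continuous u := hu.continuous
  have hDc : Continuous (fderiv ℝ u) := hu.continuous_fderiv (by norm_num)
  have hA : Continuous fun θ => V (u (circPt x₀ r θ)) := by
    simp only [circPt_eq]
    fun_prop
  have hB : Continuous fun θ => ‖fderiv ℝ u (circPt x₀ r θ) (norv θ)‖ ^ 2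
      - ‖fderiv ℝ u (circPt x₀ r θ) (tanv θ)‖ ^ 2 := by
    simp only [circPt_eq]
    fun_prop
  have hI := two_mul_setIntegral_ball_eq hε hV hu x₀ hr.le hpde
  simp only [pohozaevDensity] at hI
  rw [intervalIntegral.integral_const_mul, intervalIntegral.integral_sub
      (hA.intervalIntegrable _ _) ((hB.const_mul _).intervalIntegrable _ _),
    intervalIntegral.integral_const_mul] at hI
  have hinv : HasDerivAt (fun s : ℝ => 1 / (ε * s)) (-ε / (ε * r) ^ 2) r := by
    simp only [one_div]
    simpa using ((hasDerivAt_id r).const_mul ε).fun_inv (mul_ne_zero hε hr.ne')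
  convert! hinv.mul (hasDerivAt_setIntegral_ball (hVc.comp huc) x₀ hr) using 1
  simp only [← mul_sub, Function.comp_apply]
  rw [intervalIntegral.integral_mul_const, intervalIntegral.integral_add
      ((hB.const_mul ε).intervalIntegrable _ _) ((hA.const_mul _).intervalIntegrable _ _),
    intervalIntegral.integral_const_mul, intervalIntegral.integral_const_mul,
    (eq_div_of_mul_eq two_ne_zero ((mul_comm _ _).trans hI) : ∫ x in ball x₀ r, V (u x) = _)]
  have hr' := hr.ne'
  field_simp
  ring

/-- A map smooth on an open set coincides near a closed disk in that set with a smooth map of the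
whole plane. -/
theorem exists_contDiff_eventuallyEq {Ω : Set E2} (hΩ : IsOpen Ω)
    (hu : ContDiffOn ℝ (⊤ : ℕ∞) u Ω) {x₀ : E2} {r R : ℝ} (hr : 0 < r) (hrR : r < R)
    (hR : ball x₀ R ⊆ Ω) :
    ∃ w : E2 → Evec k, ContDiff ℝ (⊤ : ℕ∞) w ∧ ∃ ρ > r, ρ < R ∧ ∀ x ∈ ball x₀ ρ, w =ᶠ[𝓝 x] u := by
  obtain ⟨ρ, hrρ, hρR⟩ := exists_between hrR
  obtain ⟨ρ', hρρ', hρR'⟩ := exists_between hρR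
  let φ : ContDiffBump x₀ := ⟨ρ, ρ', hr.trans hrρ, hρρ'⟩
  refine ⟨fun x => φ x • u x, contDiff_iff_contDiffAt.2 fun x => ?_, ρ, hrρ, hρR, fun x hx => ?_⟩
  · by_cases hx : x ∈ closedBall x₀ ρ'
    · exact φ.contDiff.contDiffAt.smul (hu.contDiffAt
        (hΩ.mem_nhds (hR (closedBall_subset_ball hρR' hx))))
    · refine contDiffAt_const (c := 0) |>.congr_of_eventuallyEq ?_
      filter_upwards [isClosed_closedBall.isOpen_compl.mem_nhds hx] with y hy
      rw [φ.zero_of_le_dist (not_le.1 (mem_closedBall.not.1 hy)).le, zero_smul]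
  · filter_upwards [isOpen_ball.mem_nhds hx] with y hy
    rw [φ.one_of_mem_closedBall (ball_subset_closedBall hy), one_smul]

theorem lap_congr_of_eventuallyEq {w : E2 → Evec k} {x : E2} (h : w =ᶠ[𝓝 x] u) :
    lap w x = lap u x := by
  have hp : ∀ i, pder w i =ᶠ[𝓝 x] pder u i := fun i =>
    (h.fderiv (𝕜 := ℝ)).mono fun y hy => congrArg (fun L => L (b2 i)) hy
  exact Finset.sum_congr rfl fun i _ => by rw [(hp i).fderiv_eq]

end Pohozaev

/-- monotonicity-type formula for the potential. For a
solution on `Ω` and `0 < r < dist(x₀,∂Ω)`, the function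
`r ↦ (1/(εr))∫_{D(x₀,r)} V(u_ε)` is differentiable with derivative
`(1/(4r))∫_{∂D(x₀,r)}(ε|∂u/∂ν|² − ε|∂u/∂τ|² + (2/ε)V(u_ε)) dℓ`, the boundary
circle being parametrized by arclength `dℓ = r dθ`. -/
theorem statement_13 (k : ℕ) (hk : 1 ≤ k) (V : Evec k → ℝ) (hV : IsMultiWell V)
    (Ω : Set E2) (hΩo : IsOpen Ω) (hΩb : IsBounded Ω)
    (ε : ℝ) (hε : 0 < ε)
    (u : E2 → Evec k) (hu : IsSolution V ε Ω u)
    (x₀ : E2) (hx₀ : x₀ ∈ Ω)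
    (r : ℝ) (hr0 : 0 < r) (hr : r < infDist x₀ Ωᶜ) :
    HasDerivAt (fun s : ℝ => (1 / (ε * s)) * ∫ x in ball x₀ s, V (u x))
      ((1 / (4 * r)) * ∫ θ in (0 : ℝ)..(2 * Real.pi),
        (ε * ‖fderiv ℝ u (circPt x₀ r θ) (norv θ)‖ ^ 2 -
          ε * ‖fderiv ℝ u (circPt x₀ r θ) (tanv θ)‖ ^ 2 +
          (2 / ε) * V (u (circPt x₀ r θ))) * r) r := by

  have hball : ball x₀ (infDist x₀ Ωᶜ) ⊆ Ω := fun x hx => by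
    by_contra hxΩ
    exact (infDist_le_dist_of_mem (x := x₀) hxΩ).not_gt (by rwa [dist_comm])
  obtain ⟨w, hw, ρ, hrρ, hρR, hwu⟩ := exists_contDiff_eventuallyEq hΩo hu.1 hr0 hr hball
  have hcirc : ∀ θ, circPt x₀ r θ ∈ ball x₀ ρ := fun θ => by
    rwa [mem_ball, dist_circPt x₀ hr0.le]
  have hpde : ∀ x ∈ closedBall x₀ r, lap w x = (ε ^ 2)⁻¹ • gradient V (w x) := fun x hx => by
    have hxρ := closedBall_subset_ball hrρ hx
    rw [lap_congr_of_eventuallyEq (hwu x hxρ), (hwu x hxρ).eq_of_nhds]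
    exact hu.2 x (hball (ball_subset_ball hρR.le hxρ))
  have hV1 : ContDiff ℝ 1 V := hV.smooth.of_le (mod_cast le_top)
  have hw2 : ContDiff ℝ 2 w := hw.of_le (WithTop.coe_le_coe.2 le_top)
  have h := hasDerivAt_potential_of_contDiff hε.ne' hV1 hw2 x₀ hr0 hpde
  simp only [fun θ => (hwu _ (hcirc θ)).eq_of_nhds,
    fun θ => (hwu _ (hcirc θ)).fderiv_eq (𝕜 := ℝ)] at h
  refine h.congr_of_eventuallyEq ?_
  filter_upwards [gt_mem_nhds hrρ] with s hs
  rw [setIntegral_congr_fun measurableSet_ball fun x hx =>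
    congrArg V (hwu x (ball_subset_ball hs.le hx)).eq_of_nhds.symm]
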